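/- arXiv:2501.07903 — 3 statements merged into one kernel-verified Lean document; each statement's English description precedes it below -/
import Mathlib

section
/- Similarity lower bound (Eq. 3): For any two datasets D_old and D_new (finite multisets of labelled observations) and any depth limit d, the optimal misclassification scores satisfy θ(D_new, d) ≥ θ(D_old, d) − card(D_old − D_new), where D_old − D_new is the multiset difference. -/
open scoped Classical

/-- A binary axis-aligned decision tree over `p` features with labels in `Y`:
either a leaf carrying a label, or a node carrying a feature, a threshold,
and two subtrees. -/
inductive DTree (p : ℕ) (Y : Type) : Type
  | leaf (lab : Y) : DTree p Y
  | node (f : Fin p) (τ : ℝ) (l r : DTree p Y) : DTree p Y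

namespace DTree

/-- A leaf classifies every `x` as its label; a node classifies `x` by the left
subtree if `x f ≤ τ` and by the right subtree otherwise. -/
noncomputable def classify {p : ℕ} {Y : Type} : DTree p Y → (Fin p → ℝ) → Y
  | leaf lab, _ => lab
  | node f τ l r, x => if x f ≤ τ then l.classify x else r.classify x

/-- The depth of a leaf is 0; the depth of a node is 1 plus the maximum of the
depths of its subtrees. -/
def depth {p : ℕ} {Y : Type} : DTree p Y → ℕ
  | leaf _ => 0
  | node _ _ l r => 1 + max l.depth r.depth

end DTree

/-- `errors t D` is the number of observations of `D` misclassified by `t`. -/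
noncomputable def errors {p : ℕ} {Y : Type} (t : DTree p Y)
    (D : Multiset ((Fin p → ℝ) × Y)) : ℕ :=
  (D.map fun xy => if t.classify xy.1 = xy.2 then 0 else 1).sum

/-- `theta D d`: the optimal misclassification score, i.e. the minimum of
`errors t D` over all decision trees `t` of depth at most `d`. -/
noncomputable def theta {p : ℕ} {Y : Type} (D : Multiset ((Fin p → ℝ) × Y))
    (d : ℕ) : ℕ :=
  sInf {n | ∃ t : DTree p Y, t.depth ≤ d ∧ errors t D = n}

/-- `dle D f τ = D(f ≤ τ)`: the sub-multiset of observations with `x f ≤ τ`. -/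
noncomputable def dle {p : ℕ} {Y : Type} (D : Multiset ((Fin p → ℝ) × Y))
    (f : Fin p) (τ : ℝ) : Multiset ((Fin p → ℝ) × Y) :=
  D.filter fun xy => xy.1 f ≤ τ

/-- `dgt D f τ = D(f > τ)`: the sub-multiset of observations with `x f > τ`. -/
noncomputable def dgt {p : ℕ} {Y : Type} (D : Multiset ((Fin p → ℝ) × Y))
    (f : Fin p) (τ : ℝ) : Multiset ((Fin p → ℝ) × Y) :=
  D.filter fun xy => τ < xy.1 f

/-- `zf D f τ = z_f(τ) := card(D(f ≤ τ))`. -/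
noncomputable def zf {p : ℕ} {Y : Type} (D : Multiset ((Fin p → ℝ) × Y))
    (f : Fin p) (τ : ℝ) : ℕ :=
  (dle D f τ).card

/-- `splitScore D d f τ = Split(D, d, f, τ) := θ(D(f ≤ τ), d−1) + θ(D(f > τ), d−1)`. -/
noncomputable def splitScore {p : ℕ} {Y : Type} (D : Multiset ((Fin p → ℝ) × Y))
    (d : ℕ) (f : Fin p) (τ : ℝ) : ℕ :=
  theta (dle D f τ) (d - 1) + theta (dgt D f τ) (d - 1)

/-- The multiset of values of feature `f` in `D`. -/
noncomputable def featureVals {p : ℕ} {Y : Type} (D : Multiset ((Fin p → ℝ) × Y))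
    (f : Fin p) : Multiset ℝ :=
  D.map fun xy => xy.1 f

/-- `midpoints D f = S^f`: the set of midpoints `(a + b) / 2` over all pairs
`a < b` of consecutive distinct values of feature `f` in `D` (i.e. no feature
value lies strictly between `a` and `b`). -/
noncomputable def midpoints {p : ℕ} {Y : Type} (D : Multiset ((Fin p → ℝ) × Y))
    (f : Fin p) : Set ℝ :=
  {m | ∃ a b : ℝ, a ∈ featureVals D f ∧ b ∈ featureVals D f ∧ a < b ∧
    (∀ c ∈ featureVals D f, ¬(a < c ∧ c < b)) ∧ m = (a + b) / 2}

/-- `leafScore D = L(D)`: the best leaf score, the minimum over labels `ŷ` of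
the number of observations of `D` whose label differs from `ŷ`. -/
noncomputable def leafScore {p : ℕ} {Y : Type} (D : Multiset ((Fin p → ℝ) × Y)) : ℕ :=
  sInf {n | ∃ lab : Y, n = (D.map fun xy => if xy.2 = lab then 0 else 1).sum}

theorem errors_add {p : ℕ} {Y : Type} (t : DTree p Y)
    (D E : Multiset ((Fin p → ℝ) × Y)) : errors t (D + E) = errors t D + errors t E := by
  simp [errors]

theorem errors_mono {p : ℕ} {Y : Type} (t : DTree p Y)
    {D E : Multiset ((Fin p → ℝ) × Y)} (h : D ≤ E) : errors t D ≤ errors t E := by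
  obtain ⟨F, rfl⟩ := Multiset.le_iff_exists_add.mp h
  simp [errors_add]

theorem errors_le_card {p : ℕ} {Y : Type} (t : DTree p Y)
    (D : Multiset ((Fin p → ℝ) × Y)) : errors t D ≤ D.card := by
  have h := Multiset.sum_le_card_nsmul
    (D.map fun xy => if t.classify xy.1 = xy.2 then 0 else 1) 1 (by
      intro n hn
      obtain ⟨xy, -, rfl⟩ := Multiset.mem_map.mp hn
      split_ifs <;> simp)
  simpa [errors] using h

theorem theta_le_errors {p : ℕ} {Y : Type} (D : Multiset ((Fin p → ℝ) × Y)) {d : ℕ}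
    {t : DTree p Y} (ht : t.depth ≤ d) : theta D d ≤ errors t D :=
  Nat.sInf_le ⟨t, ht, rfl⟩

theorem exists_errors_eq_theta {p : ℕ} {Y : Type} [Nonempty Y]
    (D : Multiset ((Fin p → ℝ) × Y)) (d : ℕ) :
    ∃ t : DTree p Y, t.depth ≤ d ∧ errors t D = theta D d := by
  obtain ⟨lab⟩ := ‹Nonempty Y›
  exact Nat.sInf_mem (s := {n | ∃ t : DTree p Y, t.depth ≤ d ∧ errors t D = n})
    ⟨_, DTree.leaf lab, Nat.zero_le d, rfl⟩

/-- Similarity lower bound (Eq. 3): for any two datasets `Dold` and `Dnew` and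
any depth limit `d`, `θ(Dnew, d) ≥ θ(Dold, d) − card(Dold − Dnew)`. -/
theorem similarity_lower_bound {p : ℕ} {Y : Type} [Fintype Y] [Nonempty Y]
    (Dold Dnew : Multiset ((Fin p → ℝ) × Y)) (d : ℕ) :
    (theta Dnew d : ℤ) ≥ (theta Dold d : ℤ) - ((Dold - Dnew).card : ℤ) := by
  obtain ⟨t, ht, h_opt⟩ := exists_errors_eq_theta Dnew d
  have h_old := theta_le_errors Dold ht
  have h_union := errors_mono t (le_tsub_add : Dold ≤ Dold - Dnew + Dnew)
  rw [errors_add] at h_union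
  have h_card := errors_le_card t (Dold - Dnew)
  omega
end

section
/- Theorem 2 (zero-error subtree pruning): let D be a dataset, d ≥ 1, f : Fin p a feature, and w a threshold with split score θ_w = Split(D, d, f, w). If the left subtree score θ(D(f ≤ w), d−1) is zero, then every threshold u ≤ w satisfies Split(D, d, f, u) ≥ θ_w. Similarly, if the right subtree score θ(D(f > w), d−1) is zero, then every threshold v ≥ w satisfies Split(D, d, f, v) ≥ θ_w. -/
open scoped Classical

/-- The optimal misclassification score is monotone in the dataset. -/
theorem theta_mono {p : ℕ} {Y : Type} [Nonempty Y]
    {D E : Multiset ((Fin p → ℝ) × Y)} (h : D ≤ E) (d : ℕ) : theta D d ≤ theta E d := by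
  have hne : {n | ∃ t : DTree p Y, t.depth ≤ d ∧ errors t E = n}.Nonempty :=
    ⟨_, DTree.leaf (Classical.arbitrary Y), Nat.zero_le _, rfl⟩
  obtain ⟨t, ht, hE⟩ := Nat.sInf_mem hne
  calc theta D d ≤ errors t D := Nat.sInf_le ⟨t, ht, rfl⟩
    _ ≤ errors t E := errors_mono t h
    _ = theta E d := hE

theorem dle_mono {p : ℕ} {Y : Type} (D : Multiset ((Fin p → ℝ) × Y)) (f : Fin p)
    {u v : ℝ} (h : u ≤ v) : dle D f u ≤ dle D f v :=
  Multiset.monotone_filter_right D fun _ hx => hx.trans h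

theorem dgt_anti {p : ℕ} {Y : Type} (D : Multiset ((Fin p → ℝ) × Y)) (f : Fin p)
    {u v : ℝ} (h : u ≤ v) : dgt D f v ≤ dgt D f u :=
  Multiset.monotone_filter_right D fun _ hx => h.trans_lt hx

/-- Theorem 2 (zero-error subtree pruning): if the left subtree score
`θ(D(f ≤ w), d−1)` is zero, then every threshold `u ≤ w` satisfies
`Split(D, d, f, u) ≥ Split(D, d, f, w)`; similarly if the right subtree score
`θ(D(f > w), d−1)` is zero, then every `v ≥ w` satisfies
`Split(D, d, f, v) ≥ Split(D, d, f, w)`. -/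
theorem zero_error_subtree_pruning {p : ℕ} {Y : Type} [Fintype Y] [Nonempty Y]
    (D : Multiset ((Fin p → ℝ) × Y)) (d : ℕ) (hd : 1 ≤ d) (f : Fin p) (w : ℝ) :
    (theta (dle D f w) (d - 1) = 0 →
      ∀ u : ℝ, u ≤ w → splitScore D d f u ≥ splitScore D d f w) ∧
    (theta (dgt D f w) (d - 1) = 0 →
      ∀ v : ℝ, w ≤ v → splitScore D d f v ≥ splitScore D d f w) := by
  refine ⟨fun h u hu => ?_, fun h v hv => ?_⟩
  · have := theta_mono (dgt_anti D f hu) (d - 1)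
    unfold splitScore
    omega
  · have := theta_mono (dle_mono D f hv) (d - 1)
    unfold splitScore
    omega
end

section
/- Sufficiency of midpoint thresholds: let D be a dataset, f : Fin p a feature, and τ : ℝ a threshold such that both D(f ≤ τ) and D(f > τ) are nonempty. Then there exists a midpoint threshold τ' ∈ S^f with D(f ≤ τ') = D(f ≤ τ) and D(f > τ') = D(f > τ). -/
open scoped Classical

/-- The feature value of an observation is among the feature values of the dataset. -/
theorem mem_featureVals_of_mem {p : ℕ} {Y : Type} {D : Multiset ((Fin p → ℝ) × Y)}
    {xy : (Fin p → ℝ) × Y} (h : xy ∈ D) (f : Fin p) : xy.1 f ∈ featureVals D f :=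
  Multiset.mem_map_of_mem (fun xy => xy.1 f) h

/-- A threshold with feature values on both sides lies between two consecutive ones. -/
theorem exists_consecutive_around {s : Multiset ℝ} {τ : ℝ}
    (hL : ∃ c ∈ s, c ≤ τ) (hR : ∃ c ∈ s, τ < c) :
    ∃ a ∈ s, ∃ b ∈ s, a ≤ τ ∧ τ < b ∧ ∀ c ∈ s, (c ≤ τ → c ≤ a) ∧ (τ < c → b ≤ c) := by
  obtain ⟨u, hu, huτ⟩ := hL
  obtain ⟨v, hv, hvτ⟩ := hR
  obtain ⟨a, ha, hmax⟩ := (s.toFinset.filter (· ≤ τ)).exists_max_image id ⟨u, by simp [hu, huτ]⟩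
  obtain ⟨b, hb, hmin⟩ := (s.toFinset.filter (τ < ·)).exists_min_image id ⟨v, by simp [hv, hvτ]⟩
  simp only [Finset.mem_filter, Multiset.mem_toFinset, id] at ha hb hmax hmin
  exact ⟨a, ha.1, b, hb.1, ha.2, hb.2, fun c hc =>
    ⟨fun h => hmax c ⟨hc, h⟩, fun h => hmin c ⟨hc, h⟩⟩⟩

/-- Sufficiency of midpoint thresholds: if both `D(f ≤ τ)` and `D(f > τ)` are
nonempty, then there exists a midpoint threshold `τ' ∈ S^f` with
`D(f ≤ τ') = D(f ≤ τ)` and `D(f > τ') = D(f > τ)`. -/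
theorem midpoint_thresholds_suffice {p : ℕ} {Y : Type} [Fintype Y] [Nonempty Y]
    (D : Multiset ((Fin p → ℝ) × Y)) (f : Fin p) (τ : ℝ)
    (hL : dle D f τ ≠ 0) (hR : dgt D f τ ≠ 0) :
    ∃ τ' ∈ midpoints D f, dle D f τ' = dle D f τ ∧ dgt D f τ' = dgt D f τ := by
  obtain ⟨u, hu⟩ := Multiset.exists_mem_of_ne_zero hL
  obtain ⟨v, hv⟩ := Multiset.exists_mem_of_ne_zero hR
  obtain ⟨huD, huτ⟩ := Multiset.mem_filter.1 hu
  obtain ⟨hvD, hvτ⟩ := Multiset.mem_filter.1 hv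
  obtain ⟨a, ha, b, hb, haτ, hτb, hab⟩ := exists_consecutive_around
    ⟨_, mem_featureVals_of_mem huD f, huτ⟩ ⟨_, mem_featureVals_of_mem hvD f, hvτ⟩
  have key : ∀ xy ∈ D, xy.1 f ≤ (a + b) / 2 ↔ xy.1 f ≤ τ := by
    intro xy hxy
    obtain ⟨h₁, h₂⟩ := hab _ (mem_featureVals_of_mem hxy f)
    refine ⟨fun h => ?_, fun h => by linarith [h₁ h]⟩
    by_contra! hτ
    linarith [h₂ hτ]
  refine ⟨(a + b) / 2, ⟨a, b, ha, hb, haτ.trans_lt hτb, fun c hc hacb => ?_, rfl⟩,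
    Multiset.filter_congr key, Multiset.filter_congr fun xy hxy => ?_⟩
  · rcases le_or_gt c τ with h | h
    · exact hacb.1.not_ge ((hab c hc).1 h)
    · exact hacb.2.not_ge ((hab c hc).2 h)
  · simpa only [not_le] using not_congr (key xy hxy)
end
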